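/- arXiv:2307.08505 — 5 statements merged into one kernel-verified Lean document; each statement's English description precedes it below -/
import Mathlib

section
/- Let G be a cactus graph, let b be a positive integer, let r be an articulation point of G, and let f be a vertex with d(f,r) > ⌈1.75b⌉. If no vertex v lying on a shortest path from f to r with ⌈0.25b⌉ ≤ d(f,v) ≤ ⌈1.75b⌉ is an articulation point of G, then G contains a simple cycle of length at least 3b. -/
open SimpleGraph

/-- A cactus graph: a connected graph in which any two distinct simple cycles
share at most one vertex. -/
def IsCactus {V : Type*} (G : SimpleGraph V) : Prop :=
  G.Connected ∧ ∀ ⦃u v : V⦄ (c₁ : G.Walk u u) (c₂ : G.Walk v v),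
    c₁.IsCycle → c₂.IsCycle →
    {x | x ∈ c₁.support} ≠ {x | x ∈ c₂.support} →
    ({x | x ∈ c₁.support} ∩ {x | x ∈ c₂.support}).Subsingleton

/-- An articulation point: a vertex whose removal disconnects the graph. -/
def IsArticulation {V : Type*} (G : SimpleGraph V) (v : V) : Prop :=
  ¬ (G.induce {w | w ≠ v}).Connected

/-- The burning number of an undirected graph: the least `k` for which there is a
burning sequence `x 0, …, x (k-1)`, where `x i` (chosen at round `i`, `0`-indexed)
burns all vertices within distance `k - 1 - i` by the end of the process. -/
noncomputable def burnNumber {V : Type*} (G : SimpleGraph V) : ℕ :=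
  sInf {k | ∃ x : Fin k → V, ∀ v, ∃ i : Fin k, G.dist (x i) v ≤ k - 1 - (i : ℕ)}

section Cactus

variable {V : Type*} {G : SimpleGraph V}

/-- Two neighbours of a vertex that is not an articulation point lie on a common cycle with it. -/
theorem exists_isCycle_of_not_isArticulation {u v w : V} (hv : ¬ IsArticulation G v)
    (hvu : G.Adj v u) (hvw : G.Adj v w) (huw : u ≠ w) :
    ∃ c : G.Walk v v, c.IsCycle ∧ u ∈ c.support ∧ w ∈ c.support := by
  classical
  have hc : (G.induce {x | x ≠ v}).Connected := not_not.mp hv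
  obtain ⟨q, hq⟩ := (hc.preconnected ⟨u, hvu.ne'⟩ ⟨w, hvw.ne'⟩).exists_isPath
  let e : G.induce {x | x ≠ v} ↪g G := Embedding.induce _
  let q' : G.Walk u w := q.map e.toHom
  have hq' : q'.IsPath := hq.map e.injective
  have hvq : v ∉ q'.support := by
    intro h
    obtain ⟨x, -, hx⟩ := List.mem_map.mp (Walk.support_map e.toHom q ▸ h)
    exact x.2 hx
  refine ⟨Walk.cons hvu (q'.concat hvw.symm), ?_, ?_, ?_⟩
  · rw [Walk.cons_isCycle_iff]
    refine ⟨hq'.concat hvq hvw.symm, fun h => ?_⟩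
    rw [Walk.edges_concat, List.concat_eq_append, List.mem_append, List.mem_singleton] at h
    rcases h with h | h
    · exact hvq (q'.fst_mem_support_of_mem_edges h)
    · rw [Sym2.eq_swap, Sym2.congr_left] at h
      exact huw h
  · simp
  · simp [Walk.support_concat]

/-- A cycle through two vertices is at least twice as long as their distance. -/
theorem two_mul_dist_le_length {u x y : V} (c : G.Walk u u)
    (hx : x ∈ c.support) (hy : y ∈ c.support) : 2 * G.dist x y ≤ c.length := by
  classical
  have hy' : y ∈ (c.rotate x hx).support := (c.mem_support_rotate_iff x hx).mpr hy
  have hlen : (c.rotate x hx).length = c.length := c.length_rotate x hx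
  have hsplit := congrArg Walk.length ((c.rotate x hx).take_spec hy')
  rw [Walk.length_append] at hsplit
  have h₁ := dist_le ((c.rotate x hx).takeUntil y hy')
  have h₂ := dist_le ((c.rotate x hx).dropUntil y hy')
  rw [dist_comm] at h₂
  omega

/-- Positions along a shortest walk measure distance. -/
theorem dist_getVert_getVert (hG : G.Connected) {f r : V} (p : G.Walk f r)
    (hp : p.length = G.dist f r) {i j : ℕ} (hij : i ≤ j) (hj : j ≤ p.length) :
    G.dist (p.getVert i) (p.getVert j) = j - i := by
  have h₁ := dist_le (p.take i)
  have h₂ := dist_le (p.drop j)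
  have h₃ := dist_le (((p.drop i).take (j - i)).copy rfl
    (by rw [Walk.drop_getVert, Nat.add_sub_cancel' hij] : _ = p.getVert j))
  have h₄ : G.dist f r ≤ G.dist f (p.getVert i) + G.dist (p.getVert i) r := hG.dist_triangle
  have h₅ : G.dist (p.getVert i) r ≤ G.dist (p.getVert i) (p.getVert j) +
      G.dist (p.getVert j) r := hG.dist_triangle
  simp only [Walk.length_copy, Walk.take_length, Walk.drop_length] at h₁ h₂ h₃
  omega

/-- In a cactus, a stretch of a path whose inner vertices are not articulation points
lies on a single cycle. -/
theorem IsCactus.exists_isCycle_of_isPath (hG : IsCactus G) {f r : V} {p : G.Walk f r}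
    (hp : p.IsPath) (a k : ℕ) (hk : a + k + 2 ≤ p.length)
    (hno : ∀ i, a < i → i ≤ a + k + 1 → ¬ IsArticulation G (p.getVert i)) :
    ∃ (u : V) (c : G.Walk u u), c.IsCycle ∧ p.getVert a ∈ c.support ∧
      p.getVert (a + k + 1) ∈ c.support ∧ p.getVert (a + k + 2) ∈ c.support := by
  have hne {i j : ℕ} (hij : i < j) (hj : j ≤ p.length) : p.getVert i ≠ p.getVert j := fun h =>
    hij.ne (hp.getVert_injOn (by simp; omega) (by simpa using hj) h)
  have key (i : ℕ) (hi : i + 2 ≤ p.length) (hn : ¬ IsArticulation G (p.getVert (i + 1))) :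
      ∃ c : G.Walk (p.getVert (i + 1)) (p.getVert (i + 1)), c.IsCycle ∧
        p.getVert i ∈ c.support ∧ p.getVert (i + 2) ∈ c.support :=
    exists_isCycle_of_not_isArticulation hn (p.adj_getVert_succ (by omega)).symm
      (p.adj_getVert_succ (by omega)) (hne (by omega) hi)
  induction k with
  | zero =>
    obtain ⟨c, hc, h₁, h₂⟩ := key a hk (hno _ (by omega) (by omega))
    exact ⟨_, c, hc, h₁, c.start_mem_support, h₂⟩
  | succ k ih =>
    obtain ⟨u, c, hc, h₁, h₂, h₃⟩ := ih (by omega) fun i h h' => hno i h (by omega)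
    obtain ⟨c', hc', h₁', h₂'⟩ := key (a + k + 1) (by omega) (hno _ (by omega) (by omega))
    have heq : {x | x ∈ c.support} = {x | x ∈ c'.support} := by
      by_contra h
      exact hne (by omega) (by omega)
        (hG.2 c c' hc hc' h ⟨h₂, h₁'⟩ ⟨h₃, c'.start_mem_support⟩)
    exact ⟨_, c', hc', heq.subset h₁, c'.start_mem_support, h₂'⟩

end Cactus

/-- Lemma 2 of the paper. In a cactus `G`, let `r` be an articulation
point and `f` a vertex with `d(f, r) > ⌈1.75b⌉`. If no vertex `v` lying on a shortest
path from `f` to `r` with `⌈0.25b⌉ ≤ d(f, v) ≤ ⌈1.75b⌉` is an articulation point,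
then `G` contains a simple cycle of length at least `3b`. -/
theorem stmt1 {V : Type*} (G : SimpleGraph V) (hG : IsCactus G)
    (b : ℕ) (hb : 0 < b) (r f : V)
    (hr : IsArticulation G r)
    (hfar : ⌈(1.75 : ℚ) * b⌉₊ < G.dist f r)
    (hno : ∀ v : V,
      (∃ p : G.Walk f r, p.IsPath ∧ p.length = G.dist f r ∧ v ∈ p.support) →
      ⌈(0.25 : ℚ) * b⌉₊ ≤ G.dist f v → G.dist f v ≤ ⌈(1.75 : ℚ) * b⌉₊ →
      ¬ IsArticulation G v) :
    ∃ (u : V) (c : G.Walk u u), c.IsCycle ∧ 3 * b ≤ c.length := by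
  obtain ⟨p, hp⟩ := hG.1.exists_walk_length_eq_dist f r
  have hpath := p.isPath_of_length_eq_dist hp
  have hlow : ⌈(0.25 : ℚ) * b⌉₊ = (b + 3) / 4 := by
    rw [Nat.ceil_eq_iff (by omega)]
    have h₁ : 4 * ((b + 3) / 4) ≤ b + 3 := by omega
    have h₂ : b ≤ 4 * ((b + 3) / 4) := by omega
    have h₃ : 1 ≤ (b + 3) / 4 := by omega
    rw [Nat.cast_sub h₃]
    generalize (b + 3) / 4 = m at *
    have h₁' : (4 * m : ℚ) ≤ b + 3 := mod_cast h₁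
    have h₂' : (b : ℚ) ≤ 4 * m := mod_cast h₂
    constructor <;> push_cast <;> linarith
  have hhigh : 7 * b ≤ 4 * ⌈(1.75 : ℚ) * b⌉₊ := by
    have h := Nat.le_ceil ((1.75 : ℚ) * b)
    have : (7 * b : ℚ) ≤ 4 * ⌈(1.75 : ℚ) * b⌉₊ := by linarith
    exact_mod_cast this
  rw [hlow] at hno
  generalize ⌈(1.75 : ℚ) * b⌉₊ = m at *
  have hdist (i : ℕ) (hi : i ≤ p.length) : G.dist f (p.getVert i) = i := by
    simpa using dist_getVert_getVert hG.1 p hp (Nat.zero_le i) hi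
  obtain ⟨u, c, hc, hx, -, hy⟩ := hG.exists_isCycle_of_isPath hpath
    ((b + 3) / 4 - 1) (m - (b + 3) / 4) (by omega) fun i h h' =>
      hno _ ⟨p, hpath, hp, p.getVert_mem_support i⟩
        (by rw [hdist i (by omega)]; omega) (by rw [hdist i (by omega)]; omega)
  refine ⟨u, c, hc, ?_⟩
  have h := two_mul_dist_le_length c hx hy
  rw [dist_getVert_getVert hG.1 p hp (by omega) (by omega)] at h
  omega
end

section
/- Let G be a cactus graph and let b and k be positive integers. If G contains k distinct simple cycles, each of length at least 3b, then G contains k paths (arcs), each of length b, that are pairwise at distance at least b; that is, for any two of these paths A₁ ≠ A₂ and every pair of vertices v₁ ∈ A₁ and v₂ ∈ A₂, d(v₁, v₂) ≥ b. -/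
open SimpleGraph

/-- The graph left after removing the edges of a walk. -/
abbrev SimpleGraph.Walk.deleteFrom {V : Type*} {G : SimpleGraph V} {u v : V} (c : G.Walk u v) :
    SimpleGraph V :=
  G.deleteEdges {e | e ∈ c.edges}

/-- Two edge-disjoint paths meeting only at their common, distinct ends form a cycle. -/
theorem isCycle_append_of_edges_disjoint {V : Type*} {G : SimpleGraph V} {u w : V}
    {p : G.Walk u w} {q : G.Walk w u} (huw : u ≠ w) (hp : p.IsPath) (hq : q.IsPath)
    (he : p.edges.Disjoint q.edges)
    (hs : ∀ x ∈ p.support, x ∈ q.support → x = u ∨ x = w) :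
    (p.append q).IsCycle := by
  rw [Walk.isCycle_def, Walk.isTrail_append]
  refine ⟨⟨hp.isTrail, hq.isTrail, he⟩, ?_, ?_⟩
  · intro h
    have h0 : (p.append q).length = 0 := by rw [h]; rfl
    rw [Walk.length_append] at h0
    exact huw (Walk.eq_of_length_eq_zero (p := p) (by omega))
  · rw [Walk.tail_support_append, List.nodup_append']
    refine ⟨hp.support_nodup.tail, hq.support_nodup.tail, fun x hxp hxq => ?_⟩
    have hp' := hp.support_nodup
    have hq' := hq.support_nodup
    rw [← Walk.cons_tail_support, List.nodup_cons] at hp' hq'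
    rcases hs x (List.mem_of_mem_tail hxp) (List.mem_of_mem_tail hxq) with rfl | rfl
    · exact hp'.1 hxp
    · exact hq'.1 hxq

/-- In a cactus, a path which avoids the edges of a cycle and, except at its ends, also its vertices
cannot join two distinct vertices of this cycle. -/
theorem IsCactus.eq_of_isPath {V : Type*} {G : SimpleGraph V} (hG : IsCactus G) {u w : V}
    {c : G.Walk u u} (hc : c.IsCycle) (hw : w ∈ c.support) {p : G.Walk u w} (hp : p.IsPath)
    (he : ∀ e ∈ p.edges, e ∉ c.edges)
    (hs : ∀ x ∈ p.support, x ∈ c.support → x = u ∨ x = w) : u = w := by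
  classical
  by_contra huw
  set q₁ := c.takeUntil w hw
  set q₂ := c.dropUntil w hw
  have hspec : q₁.append q₂ = c := c.take_spec hw
  have hcyc : (q₁.append q₂).IsCycle := hspec ▸ hc
  have hp₁ : q₁.IsPath := hc.isPath_takeUntil hw
  have hp₂ : q₂.IsPath := hcyc.isPath_of_append_right (Walk.not_nil_of_ne huw)
  have hsupp : ∀ x, x ∈ c.support ↔ x ∈ q₁.support ∨ x ∈ q₂.support := fun x => by
    rw [← hspec, Walk.mem_support_append_iff]
  have hedge : ∀ e, e ∈ c.edges ↔ e ∈ q₁.edges ∨ e ∈ q₂.edges := fun x => by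
    rw [← hspec, Walk.edges_append, List.mem_append]
  have hd₁ : (p.append q₁.reverse).IsCycle := by
    refine isCycle_append_of_edges_disjoint huw hp hp₁.reverse (fun e h₁ h₂ => ?_)
      (fun x h₁ h₂ => ?_)
    · exact he e h₁ ((hedge e).2 (.inl (by simpa using h₂)))
    · exact hs x h₁ ((hsupp x).2 (.inl (by simpa using h₂)))
  have hd₂ : (p.append q₂).IsCycle := by
    refine isCycle_append_of_edges_disjoint huw hp hp₂ (fun e h₁ h₂ => ?_) (fun x h₁ h₂ => ?_)
    · exact he e h₁ ((hedge e).2 (.inr h₂))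
    · exact hs x h₁ ((hsupp x).2 (.inr h₂))
  have key : ∀ d : G.Walk u u, d.IsCycle → w ∈ d.support → ∀ x, x ∈ c.support → x ∈ d.support := by
    intro d hd hwd x hx
    by_contra hxd
    refine huw (hG.2 c d hc hd (fun h => hxd ?_) ⟨c.start_mem_support, d.start_mem_support⟩
      ⟨hw, hwd⟩)
    have : x ∈ {x | x ∈ c.support} := hx
    rw [h] at this
    exact this
  have hsub : ∀ x ∈ c.support, x = u ∨ x = w := by
    intro x hx
    have h₁ := key _ hd₁ (by simp [Walk.mem_support_append_iff]) x hx
    have h₂ := key _ hd₂ (by simp [Walk.mem_support_append_iff]) x hx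
    rw [Walk.mem_support_append_iff] at h₁ h₂
    rcases h₁ with h₁ | h₁
    · exact hs x h₁ hx
    rcases h₂ with h₂ | h₂
    · exact hs x h₂ hx
    have hnd := hcyc.support_nodup
    rw [Walk.tail_support_append, List.nodup_append'] at hnd
    rw [Walk.support_reverse, List.mem_reverse, ← Walk.cons_tail_support, List.mem_cons] at h₁
    rw [← Walk.cons_tail_support, List.mem_cons] at h₂
    rcases h₁ with h₁ | h₁
    · exact .inl h₁
    rcases h₂ with h₂ | h₂
    · exact .inr h₂
    exact (hnd.2.2 h₁ h₂).elim
  have hle : c.support.tail.toFinset ⊆ {u, w} := fun x hx => by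
    simpa using hsub x (List.mem_of_mem_tail (List.mem_toFinset.1 hx))
  have h1 := Finset.card_le_card hle
  rw [List.toFinset_card_of_nodup hc.support_nodup, List.length_tail, Walk.length_support] at h1
  have h2 := Finset.card_le_two (a := u) (b := w)
  have h3 := hc.three_le_length
  omega

/-- In a cactus, removing the edges of a cycle separates its vertices. -/
theorem IsCactus.eq_of_reachable {V : Type*} {G : SimpleGraph V} (hG : IsCactus G) {v : V}
    {c : G.Walk v v} (hc : c.IsCycle) {u w : V} (hu : u ∈ c.support) (hw : w ∈ c.support)
    (h : c.deleteFrom.Reachable u w) : u = w := by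
  classical
  have main : ∀ (n : ℕ) (u w : V), u ∈ c.support → w ∈ c.support → ∀ p : G.Walk u w, p.IsPath →
      (∀ e ∈ p.edges, e ∉ c.edges) → p.length = n → u = w := by
    intro n
    induction n using Nat.strong_induction_on with
    | _ n ih =>
      intro u w hu hw p hp he hn
      by_cases hx : ∃ x ∈ p.support, x ∈ c.support ∧ x ≠ u ∧ x ≠ w
      · obtain ⟨x, hxp, hxc, hxu, hxw⟩ := hx
        refine (hxu (ih _ ?_ u x hu hxc (p.takeUntil x hxp) (hp.takeUntil hxp) ?_ rfl).symm).elim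
        · exact hn ▸ Walk.length_takeUntil_lt_length hxp hxw
        · exact fun e h => he e (p.edges_takeUntil_subset_edges hxp h)
      · push Not at hx
        refine hG.eq_of_isPath (hc.rotate hu) (by simpa using hw) hp (fun e h h' => ?_)
          (fun x h₁ h₂ => ?_)
        · exact he e h ((c.rotate_edges u hu).mem_iff.1 h')
        · by_cases hxu : x = u
          · exact .inl hxu
          · exact .inr (hx x h₁ (by simpa using h₂) hxu)
  obtain ⟨p, hp⟩ := h.exists_isPath
  refine main _ u w hu hw (p.mapLe (G.deleteEdges_le _)) (hp.mapLe _) (fun e h => ?_) rfl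
  rw [Walk.edges_mapLe_eq_edges] at h
  have := p.edges_subset_edgeSet h
  rw [edgeSet_deleteEdges] at this
  exact this.2

/-- Every vertex of a connected graph is joined to a closed walk without using its edges. -/
theorem SimpleGraph.Connected.exists_mem_support_reachable {V : Type*} {G : SimpleGraph V}
    (hG : G.Connected) {v : V} (c : G.Walk v v) (x : V) :
    ∃ y ∈ c.support, c.deleteFrom.Reachable x y := by
  have main : ∀ {x y : V}, G.Walk x y → y ∈ c.support →
      ∃ y ∈ c.support, c.deleteFrom.Reachable x y := by
    intro x y p hy
    induction p with
    | nil => exact ⟨_, hy, .rfl⟩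
    | @cons x z y h p ih =>
      by_cases hx : x ∈ c.support
      · exact ⟨x, hx, .rfl⟩
      · obtain ⟨t, ht, hr⟩ := ih hy
        refine ⟨t, ht, Reachable.trans (Adj.reachable ?_) hr⟩
        rw [deleteEdges_adj]
        exact ⟨h, fun h' => hx (c.fst_mem_support_of_mem_edges h')⟩
  exact main (hG x v).some c.start_mem_support

/-- A function that grows by at most one along edges is bounded via graph distance. -/
theorem SimpleGraph.Connected.le_add_dist {V : Type*} {G : SimpleGraph V} (hG : G.Connected)
    {f : V → ℕ} (hf : ∀ x y, G.Adj x y → f x ≤ f y + 1) (x y : V) :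
    f x ≤ f y + G.dist x y := by
  obtain ⟨p, hp⟩ := hG.exists_walk_length_eq_dist x y
  rw [← hp]
  clear hp
  induction p with
  | nil => simp
  | cons h p ih =>
    have := hf _ _ h
    rw [Walk.length_cons]
    omega

/-- In a cactus, a cycle starting at `r` carries a function which measures the distance along the
cycle from `r` to the projection of a vertex to the cycle, and which grows by at most one along
edges. -/
theorem IsCactus.exists_cycle_distance {V : Type*} {G : SimpleGraph V} (hG : IsCactus G) {r : V}
    {c : G.Walk r r} (hc : c.IsCycle) :
    ∃ f : V → ℕ, (∀ x, ∀ i ≤ c.length, c.deleteFrom.Reachable x (c.getVert i) →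
      f x = min i (c.length - i)) ∧ ∀ x y, G.Adj x y → f x ≤ f y + 1 := by
  have hex : ∀ x, ∃ i ≤ c.length, c.deleteFrom.Reachable x (c.getVert i) := fun x => by
    obtain ⟨y, hy, h⟩ := hG.1.exists_mem_support_reachable c x
    obtain ⟨i, rfl, hi⟩ := Walk.mem_support_iff_exists_getVert.1 hy
    exact ⟨i, hi, h⟩
  choose g hg hr using hex
  have hinj : ∀ i ≤ c.length, ∀ j ≤ c.length, c.getVert i = c.getVert j →
      min i (c.length - i) = min j (c.length - j) := by
    intro i hi j hj hij
    by_cases h0 : 1 ≤ i ∧ 1 ≤ j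
    · rw [hc.getVert_injOn ⟨h0.1, hi⟩ ⟨h0.2, hj⟩ hij]
    by_cases h1 : i ≤ c.length - 1 ∧ j ≤ c.length - 1
    · rw [hc.getVert_injOn' h1.1 h1.2 hij]
    omega
  have hf : ∀ x, ∀ i ≤ c.length, c.deleteFrom.Reachable x (c.getVert i) →
      min (g x) (c.length - g x) = min i (c.length - i) := fun x i hi h =>
    hinj _ (hg x) _ hi (hG.eq_of_reachable hc (c.getVert_mem_support _) (c.getVert_mem_support _)
      ((hr x).symm.trans h))
  refine ⟨fun x => min (g x) (c.length - g x), hf, fun x y hxy => ?_⟩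
  by_cases he : s(x, y) ∈ c.edges
  · obtain ⟨i, hi, h⟩ := (c.mk_mem_edges_iff_exists).1 he
    have h₁ := hf (c.getVert i) i hi.le .rfl
    have h₂ := hf (c.getVert (i + 1)) (i + 1) hi .rfl
    rcases Sym2.eq_iff.1 h with ⟨rfl, rfl⟩ | ⟨rfl, rfl⟩ <;> dsimp only <;> omega
  · have hadj : c.deleteFrom.Adj x y := by
      rw [deleteEdges_adj]
      exact ⟨hxy, he⟩
    have := hf x (g y) (hg y) (hadj.reachable.trans (hr y))
    dsimp only
    omega

/-- In a cactus, a cycle of length at least `3 * b` contains a path of length `b` whose vertices are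
at distance at least `b` from everything on the same side of the cycle as a given vertex. -/
theorem IsCactus.exists_path_far {V : Type*} {G : SimpleGraph V} (hG : IsCactus G) {v : V}
    {c : G.Walk v v} (hc : c.IsCycle) {b : ℕ} (hb : 0 < b) (hlen : 3 * b ≤ c.length) (r : V) :
    ∃ A : Σ u v : V, G.Walk u v, A.2.2.IsPath ∧ A.2.2.length = b ∧
      (∀ x ∈ A.2.2.support, x ∈ c.support) ∧
      ∀ x ∈ A.2.2.support, ∀ y, c.deleteFrom.Reachable r y → b ≤ G.dist x y := by
  classical
  obtain ⟨p, hp, hrp⟩ := hG.1.exists_mem_support_reachable c r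
  obtain ⟨f, hf, hlip⟩ := hG.exists_cycle_distance (hc.rotate hp)
  have hdel : (c.rotate p hp).deleteFrom = c.deleteFrom := by
    unfold Walk.deleteFrom
    congr 1
    ext e
    exact (c.rotate_edges p hp).mem_iff
  have hmem : ∀ x ∈ (((c.rotate p hp).drop b).take b).support,
      ∃ i, (c.rotate p hp).getVert i = x ∧ b ≤ i ∧ i ≤ 2 * b := by
    intro x hx
    obtain ⟨i, rfl, hi⟩ := Walk.mem_support_iff_exists_getVert.1 hx
    exact ⟨b + min b i, by rw [Walk.take_getVert, Walk.drop_getVert], by omega, by omega⟩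
  refine ⟨⟨_, _, ((c.rotate p hp).drop b).take b⟩, ((hc.rotate hp).isPath_drop hb).take b, ?_, ?_,
    ?_⟩
  · rw [Walk.take_length, Walk.drop_length, Walk.length_rotate]
    omega
  · intro x hx
    obtain ⟨i, rfl, -⟩ := hmem x hx
    exact (c.mem_support_rotate_iff p hp).1 (Walk.getVert_mem_support _ _)
  · intro x hx y hy
    obtain ⟨i, rfl, hi, hi'⟩ := hmem x hx
    have h₁ := hf _ i (by rw [Walk.length_rotate]; omega) .rfl
    have h₂ := hf y 0 (Nat.zero_le _) (by
      rw [hdel, Walk.getVert_zero]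
      exact hy.symm.trans hrp)
    have h₃ := hG.1.le_add_dist hlip ((c.rotate p hp).getVert i) y
    rw [Walk.length_rotate] at h₁
    omega

/-- In a cactus, two distinct cycles have no common edge. -/
theorem IsCactus.edges_disjoint {V : Type*} {G : SimpleGraph V} (hG : IsCactus G) {u v : V}
    {c : G.Walk u u} {d : G.Walk v v} (hc : c.IsCycle) (hd : d.IsCycle)
    (hcd : {x | x ∈ c.support} ≠ {x | x ∈ d.support}) : c.edges.Disjoint d.edges := by
  intro e h₁ h₂
  induction e with
  | _ x y =>
    exact (c.adj_of_mem_edges h₁).ne (hG.2 c d hc hd hcd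
      ⟨c.fst_mem_support_of_mem_edges h₁, d.fst_mem_support_of_mem_edges h₂⟩
      ⟨c.snd_mem_support_of_mem_edges h₁, d.snd_mem_support_of_mem_edges h₂⟩)

/-- Removing the edges of a walk keeps any edge-disjoint walk connected. -/
theorem SimpleGraph.Walk.reachable_deleteFrom {V : Type*} {G : SimpleGraph V} {u v w : V}
    {c : G.Walk u u} {d : G.Walk v w} (h : c.edges.Disjoint d.edges) {x y : V}
    (hx : x ∈ d.support) (hy : y ∈ d.support) : c.deleteFrom.Reachable x y := by
  classical
  have main : ∀ z ∈ d.support, c.deleteFrom.Reachable v z := fun z hz =>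
    ⟨(d.takeUntil z hz).toDeleteEdges _ fun e he he' =>
      h he' (d.edges_takeUntil_subset_edges hz he)⟩
  exact (main x hx).symm.trans (main y hy)

/-- In a cactus, given two distinct cycles and a vertex `r`, one of the cycles lies on the same side
of the other one as `r`. -/
theorem IsCactus.reachable_or_reachable {V : Type*} {G : SimpleGraph V} (hG : IsCactus G) {u v : V}
    {c : G.Walk u u} {d : G.Walk v v} (hc : c.IsCycle) (hd : d.IsCycle)
    (hcd : {x | x ∈ c.support} ≠ {x | x ∈ d.support}) (r : V) :
    (∀ y ∈ d.support, c.deleteFrom.Reachable r y) ∨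
      ∀ y ∈ c.support, d.deleteFrom.Reachable r y := by
  classical
  have hdis := hG.edges_disjoint hc hd hcd
  by_cases h : ∃ y ∈ d.support, c.deleteFrom.Reachable r y
  · obtain ⟨y, hy, hr⟩ := h
    exact .inl fun z hz => hr.trans (Walk.reachable_deleteFrom hdis hy hz)
  · right
    push Not at h
    obtain ⟨p, hp, ⟨q⟩⟩ := hG.1.exists_mem_support_reachable c r
    have hrp : d.deleteFrom.Reachable r p := by
      refine ⟨(q.mapLe (G.deleteEdges_le _)).toDeleteEdges _ fun e he he' => ?_⟩
      rw [Walk.edges_mapLe_eq_edges] at he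
      induction e with
      | _ x y =>
        exact h x (d.fst_mem_support_of_mem_edges he')
          (q.takeUntil x (q.fst_mem_support_of_mem_edges he)).reachable
    exact fun y hy => hrp.trans (Walk.reachable_deleteFrom hdis.symm hp hy)

/-- Lemma 3 of the paper. If a cactus `G` contains `k` distinct simple
cycles, each of length at least `3b`, then `G` contains `k` paths, each of length `b`,
that are pairwise at distance at least `b`. -/
theorem stmt2 {V : Type*} (G : SimpleGraph V) (hG : IsCactus G)
    (b k : ℕ) (hb : 0 < b) (hk : 0 < k)
    (cy : Fin k → Σ u : V, G.Walk u u)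
    (hcyc : ∀ i, (cy i).2.IsCycle)
    (hlen : ∀ i, 3 * b ≤ (cy i).2.length)
    (hdistinct : ∀ i j, i ≠ j →
      {x | x ∈ (cy i).2.support} ≠ {x | x ∈ (cy j).2.support}) :
    ∃ A : Fin k → Σ u v : V, G.Walk u v,
      (∀ i, (A i).2.2.IsPath) ∧
      (∀ i, (A i).2.2.length = b) ∧
      (∀ i j, i ≠ j → ∀ v₁ ∈ (A i).2.2.support, ∀ v₂ ∈ (A j).2.2.support,
        b ≤ G.dist v₁ v₂) := by
  obtain ⟨r⟩ := hG.1.nonempty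
  choose A hA hAlen hAsupp hAdist using fun i => hG.exists_path_far (hcyc i) hb (hlen i) r
  refine ⟨A, hA, hAlen, fun i j hij v₁ h₁ v₂ h₂ => ?_⟩
  rcases hG.reachable_or_reachable (hcyc i) (hcyc j) (hdistinct i j hij) r with h | h
  · exact hAdist i v₁ h₁ v₂ (h v₂ (hAsupp j v₂ h₂))
  · rw [dist_comm]
    exact hAdist j v₂ h₂ v₁ (h v₁ (hAsupp i v₁ h₁))
end

section
/- Let G be a cactus graph and let b be a positive integer. If G contains ⌈0.75b⌉ + 1 distinct simple cycles, each of length at least 3b, then b(G) > b. -/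
open SimpleGraph

section Cactus

variable {V : Type*} {G : SimpleGraph V}

/-- In a cactus, a walk between two vertices of a cycle that uses no edge of the cycle is closed. -/
theorem IsCactus.eq_of_walk (hG : IsCactus G) {v : V} {c : G.Walk v v} (hc : c.IsCycle)
    {a b : V} (p : G.Walk a b) (ha : a ∈ c.support) (hb : b ∈ c.support)
    (hp : ∀ e ∈ p.edges, e ∉ c.edges) : a = b := by
  classical
  induction hn : p.length using Nat.strongRec generalizing a b with | ind n ih =>
  by_contra hab
  have hpath : p.IsPath := by
    have hle := p.length_bypass_le_length
    by_cases hlt : p.bypass.length < n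
    · exact absurd (ih _ hlt p.bypass ha hb (fun e he => hp e (p.edges_bypass_subset_edges he)) rfl) hab
    · have := p.bypass_eq_self_of_length_le_length_bypass (by omega)
      rw [← this]; exact p.bypass_isPath
  have hint : ∀ z ∈ p.support, z ∈ c.support → z = a ∨ z = b := by
    intro z hz hzc
    by_contra! hne
    have h1 := ih _ (hn ▸ p.length_takeUntil_lt_length hz hne.2) (p.takeUntil z hz) ha hzc
      (fun e he => hp e (p.edges_takeUntil_subset_edges hz he)) rfl
    exact hne.1 h1.symm
  have hc' := hc.rotate ha
  have hsupp : ∀ z, z ∈ (c.rotate a ha).support ↔ z ∈ c.support :=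
    fun z => c.mem_support_rotate_iff a ha
  have hedge : ∀ e, e ∈ (c.rotate a ha).edges ↔ e ∈ c.edges :=
    fun e => (c.rotate_edges a ha).mem_iff
  generalize c.rotate a ha = d at hc' hsupp hedge
  have hbd : b ∈ d.support := (hsupp b).2 hb
  obtain ⟨q, r, hd, hq⟩ : ∃ (q : G.Walk a b) (r : G.Walk b a), d = q.append r ∧ q.IsPath :=
    ⟨_, _, (d.take_spec hbd).symm, hc'.isPath_takeUntil hbd⟩
  subst hd
  have hqc : ∀ z ∈ q.support, z ∈ c.support := fun z hz => (hsupp z).1 (by simp [hz])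
  have hpa : a ∉ p.support.tail := by
    have := hpath.support_nodup
    rw [← p.cons_tail_support, List.nodup_cons] at this
    exact this.1
  have hqb : b ∉ q.reverse.support.tail := by
    have := hq.reverse.support_nodup
    rw [← q.reverse.cons_tail_support, List.nodup_cons] at this
    exact this.1
  have hcyc : (p.append q.reverse).IsCycle := by
    refine hpath.isCycle_append hq.reverse ?_ ?_
    · intro z hz hz'
      have hzq : z ∈ q.support := by
        have := List.mem_of_mem_tail hz'
        simpa using this
      rcases hint z (List.mem_of_mem_tail hz) (hqc z hzq) with rfl | rfl
      · exact hpa hz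
      · exact hqb hz'
    · by_contra! hlen
      have hp1 : s(a, b) ∈ p.edges := by
        cases p with
        | nil => exact absurd rfl hab
        | cons h p' =>
          cases p' with
          | nil => simp
          | cons h' p'' => simp at hlen
      have hq1 : s(a, b) ∈ q.edges := by
        cases q with
        | nil => exact absurd rfl hab
        | cons h p' =>
          cases p' with
          | nil => simp
          | cons h' p'' => simp at hlen
      exact hp _ hp1 ((hedge _).1 (by simp [hq1]))
  have hne : {x | x ∈ (p.append q.reverse).support} ≠ {x | x ∈ c.support} := by
    intro heq
    have hsub : ∀ z ∈ c.support, z ∈ q.support := by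
      intro z hz
      have : z ∈ (p.append q.reverse).support := by
        have : z ∈ {x | x ∈ c.support} := hz
        rwa [← heq] at this
      rw [Walk.mem_support_append_iff, Walk.support_reverse, List.mem_reverse] at this
      rcases this with h | h
      · rcases hint z h hz with rfl | rfl <;> simp
      · exact h
    have hpsub : ∀ z ∈ p.support, z ∈ c.support := by
      intro z hz
      have : z ∈ {x | x ∈ (p.append q.reverse).support} := by simp [hz]
      rwa [heq] at this
    have hp1 : s(a, b) ∈ p.edges := by
      cases p with
      | nil => exact absurd rfl hab
      | @cons _ w _ h p' =>
        rcases hint w (by simp) (hpsub w (by simp)) with rfl | rfl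
        · exact absurd h (G.irrefl)
        · simp
    have hr1 : s(a, b) ∈ r.edges := by
      cases r with
      | nil => exact absurd rfl hab
      | @cons _ w _ h r' =>
        have hwq : w ∈ q.support := hsub w ((hsupp w).1 (by simp))
        have hnd := hc'.support_nodup
        rw [Walk.tail_support_append, List.nodup_append'] at hnd
        have hwt : w ∉ q.support.tail := fun h' => hnd.2.2 h' (by simp)
        rw [← q.cons_tail_support, List.mem_cons] at hwq
        rcases hwq with rfl | h'
        · simp [Sym2.eq_swap]
        · exact absurd h' hwt
    exact hp _ hp1 ((hedge _).1 (by simp [hr1]))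
  exact hab (hG.2 _ c hcyc hc hne ⟨by simp, ha⟩ ⟨by simp, hb⟩)

/-- Every vertex of a connected graph can be joined to a cycle without using its edges. -/
theorem SimpleGraph.Connected.exists_reachable_deleteEdges (hG : G.Connected) {v : V} (c : G.Walk v v)
    (x : V) : ∃ g ∈ c.support, (G.deleteEdges {e | e ∈ c.edges}).Reachable x g := by
  obtain ⟨p⟩ := hG.preconnected x v
  induction p with
  | nil => exact ⟨_, c.start_mem_support, .rfl⟩
  | @cons x y w h p ih =>
    by_cases hx : x ∈ c.support
    · exact ⟨x, hx, .rfl⟩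
    · obtain ⟨g, hg, hr⟩ := ih c
      refine ⟨g, hg, Reachable.trans (Adj.reachable ?_) hr⟩
      rw [deleteEdges_adj]
      exact ⟨h, fun he => hx (c.fst_mem_support_of_mem_edges he)⟩

theorem IsCactus.eq_of_reachable_s3 (hG : IsCactus G) {v : V} {c : G.Walk v v} (hc : c.IsCycle)
    {a b : V} (ha : a ∈ c.support) (hb : b ∈ c.support)
    (h : (G.deleteEdges {e | e ∈ c.edges}).Reachable a b) : a = b := by
  obtain ⟨p⟩ := h
  refine hG.eq_of_walk hc (p.mapLe (G.deleteEdges_le _)) ha hb fun e he => ?_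
  rw [Walk.edges_mapLe_eq_edges] at he
  have := p.edges_subset_edgeSet he
  rw [edgeSet_deleteEdges] at this
  exact this.2

/-- The vertex of the cycle `c` at which `x` is attached: the one joined to `x` by a walk avoiding
the edges of `c`. -/
noncomputable def cycleGate (hG : G.Connected) {v : V} (c : G.Walk v v) (x : V) : V :=
  (hG.exists_reachable_deleteEdges c x).choose

theorem cycleGate_mem (hG : G.Connected) {v : V} (c : G.Walk v v) (x : V) :
    cycleGate hG c x ∈ c.support :=
  (hG.exists_reachable_deleteEdges c x).choose_spec.1

theorem reachable_cycleGate (hG : G.Connected) {v : V} (c : G.Walk v v) (x : V) :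
    (G.deleteEdges {e | e ∈ c.edges}).Reachable x (cycleGate hG c x) :=
  (hG.exists_reachable_deleteEdges c x).choose_spec.2

theorem IsCactus.gate_eq_of_reachable (hG : IsCactus G) {v : V} {c : G.Walk v v} (hc : c.IsCycle) {x y : V}
    (h : (G.deleteEdges {e | e ∈ c.edges}).Reachable x y) : cycleGate hG.1 c x = cycleGate hG.1 c y :=
  hG.eq_of_reachable_s3 hc (cycleGate_mem _ _ _) (cycleGate_mem _ _ _)
    (((reachable_cycleGate hG.1 c x).symm.trans h).trans (reachable_cycleGate hG.1 c y))

theorem IsCactus.gate_eq_self (hG : IsCactus G) {v : V} {c : G.Walk v v} (hc : c.IsCycle) {x : V}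
    (h : x ∈ c.support) : cycleGate hG.1 c x = x :=
  hG.eq_of_reachable_s3 hc (cycleGate_mem _ _ _) h (reachable_cycleGate hG.1 c x).symm

theorem IsCactus.gate_eq_of_adj (hG : IsCactus G) {v : V} {c : G.Walk v v} (hc : c.IsCycle) {x y : V}
    (h : G.Adj x y) (he : s(x, y) ∉ c.edges) : cycleGate hG.1 c x = cycleGate hG.1 c y :=
  hG.gate_eq_of_reachable hc (Adj.reachable (by simpa using ⟨h, he⟩))

theorem IsCactus.gate_mem_support (hG : IsCactus G) {v : V} {c : G.Walk v v} (hc : c.IsCycle) {x y : V}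
    (p : G.Walk x y) (h : cycleGate hG.1 c x ≠ cycleGate hG.1 c y) : cycleGate hG.1 c x ∈ p.support := by
  induction p with
  | nil => exact absurd rfl h
  | @cons x z y hxz p ih =>
    by_cases he : s(x, z) ∈ c.edges
    · rw [hG.gate_eq_self hc (c.fst_mem_support_of_mem_edges he)]
      simp
    · have := hG.gate_eq_of_adj hc hxz he
      rw [this] at h ⊢
      simp [ih h]

theorem IsCactus.dist_eq_add_of_gate_ne (hG : IsCactus G) {v : V} {c : G.Walk v v} (hc : c.IsCycle)
    {x y : V} (h : cycleGate hG.1 c x ≠ cycleGate hG.1 c y) :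
    G.dist x y = G.dist x (cycleGate hG.1 c x) + G.dist (cycleGate hG.1 c x) y := by
  classical
  refine le_antisymm hG.1.dist_triangle ?_
  obtain ⟨p, hp⟩ := hG.1.exists_walk_length_eq_dist x y
  have hm := hG.gate_mem_support hc p h
  have := congrArg Walk.length (p.take_spec hm)
  rw [Walk.length_append] at this
  rw [← hp, ← this]
  exact add_le_add (dist_le _) (dist_le _)

/-- In a cactus, a cycle is attached to any other cycle at a single vertex. -/
theorem IsCactus.gate_eq_of_mem_cycle (hG : IsCactus G) {v w : V} {c : G.Walk v v} {d : G.Walk w w}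
    (hc : c.IsCycle) (hd : d.IsCycle) (hne : {x | x ∈ c.support} ≠ {x | x ∈ d.support})
    {x y : V} (hx : x ∈ d.support) (hy : y ∈ d.support) :
    cycleGate hG.1 c x = cycleGate hG.1 c y := by
  classical
  have key : ∀ z ∈ d.support, cycleGate hG.1 c w = cycleGate hG.1 c z := by
    intro z hz
    have hedge : ∀ e ∈ d.edges, e ∉ c.edges := by
      intro e
      induction e using Sym2.ind with | _ a b =>
      intro h1 h2
      exact (d.adj_of_mem_edges h1).ne (hG.2 c d hc hd hne
        ⟨c.fst_mem_support_of_mem_edges h2, d.fst_mem_support_of_mem_edges h1⟩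
        ⟨c.snd_mem_support_of_mem_edges h2, d.snd_mem_support_of_mem_edges h1⟩)
    exact hG.gate_eq_of_reachable hc
      ⟨(d.takeUntil z hz).toDeleteEdges {e | e ∈ c.edges} fun e he =>
        hedge e (d.edges_takeUntil_subset_edges hz he)⟩
  rw [← key x hx, ← key y hy]

theorem IsCactus.exists_getVert_eq_gate (hG : IsCactus G) {g : V} {c : G.Walk g g} (hc : c.IsCycle) {x y : V}
    (p : G.Walk y x) (hx : cycleGate hG.1 c x = g) :
    ∃ t ≤ c.length, (t ≤ p.length ∨ c.length ≤ t + p.length) ∧ cycleGate hG.1 c y = c.getVert t := by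
  induction p with
  | nil => exact ⟨0, by simp, by simp, by simpa using hx⟩
  | @cons y z x h p ih =>
    obtain ⟨t, htL, ht, hz⟩ := ih hx
    by_cases he : s(y, z) ∈ c.edges
    · rw [hG.gate_eq_self hc (c.snd_mem_support_of_mem_edges he)] at hz
      rw [hG.gate_eq_self hc (c.fst_mem_support_of_mem_edges he)]
      have hn : y ∈ c.toSubgraph.neighborSet z := by
        rw [Subgraph.mem_neighborSet, Walk.adj_toSubgraph_iff_mem_edges, Sym2.eq_swap]
        exact he
      have h3 := hc.three_le_length
      rw [Walk.length_cons]
      by_cases h0 : t = 0 ∨ t = c.length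
      · have hzg : z = g := by rcases h0 with rfl | rfl <;> simpa using hz
        rw [hzg, hc.neighborSet_toSubgraph_endpoint] at hn
        rcases hn with rfl | rfl
        · exact ⟨1, by omega, by omega, rfl⟩
        · exact ⟨c.length - 1, by omega, by omega, rfl⟩
      · rw [hz, hc.neighborSet_toSubgraph_internal (by omega) (by omega)] at hn
        rcases hn with rfl | rfl
        · exact ⟨t - 1, by omega, by omega, rfl⟩
        · exact ⟨t + 1, by omega, by omega, rfl⟩
    · rw [hG.gate_eq_of_adj hc h he]
      exact ⟨t, htL, by rw [Walk.length_cons]; omega, hz⟩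

/-- In a cactus, a ball of radius `r` contains at most `2 * r + 1` vertices of any cycle. -/
theorem IsCactus.card_ball_inter_cycle_le [DecidableEq V] (hG : IsCactus G) {v : V} {c : G.Walk v v}
    (hc : c.IsCycle) (x : V) (r : ℕ) :
    (c.support.toFinset.filter fun y => G.dist x y ≤ r).card ≤ 2 * r + 1 := by
  wlog hv : cycleGate hG.1 c x = v generalizing v
  · have hm := cycleGate_mem hG.1 c x
    have hc' := hc.rotate hm
    have hsupp : (c.rotate _ hm).support.toFinset = c.support.toFinset := by
      ext z; simp
    have hg : cycleGate hG.1 (c.rotate _ hm) x = cycleGate hG.1 c x := by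
      refine hG.eq_of_reachable_s3 hc' (cycleGate_mem _ _ _)
        (by rw [c.mem_support_rotate_iff]; exact hm) ((reachable_cycleGate hG.1 _ x).symm.trans ?_)
      have : {e | e ∈ (c.rotate _ hm).edges} = {e | e ∈ c.edges} :=
        Set.ext fun e => (c.rotate_edges _ hm).mem_iff
      rw [this]
      exact reachable_cycleGate hG.1 c x
    rw [← hsupp]
    exact this hc' hg
  have hsub : (c.support.toFinset.filter fun y => G.dist x y ≤ r) ⊆
      (Finset.Icc 1 r ∪ Finset.Icc (c.length - r) c.length).image c.getVert := by
    intro y hy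
    rw [Finset.mem_filter, List.mem_toFinset] at hy
    obtain ⟨p, hp⟩ := hG.1.exists_walk_length_eq_dist y x
    obtain ⟨t, htL, ht, hyt⟩ := hG.exists_getVert_eq_gate hc p hv
    rw [hG.gate_eq_self hc hy.1] at hyt
    rw [hp, G.dist_comm] at ht
    rw [Finset.mem_image]
    rcases Nat.eq_zero_or_pos t with rfl | h0
    · exact ⟨c.length, by simp, by simpa using hyt.symm⟩
    · refine ⟨t, ?_, hyt.symm⟩
      simp only [Finset.mem_union, Finset.mem_Icc]
      omega
  refine (Finset.card_le_card hsub).trans (Finset.card_image_le.trans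
    ((Finset.card_union_le _ _).trans ?_))
  simp only [Nat.card_Icc]
  omega

theorem SimpleGraph.Walk.IsCycle.card_support_toFinset [DecidableEq V] {v : V} {c : G.Walk v v}
    (hc : c.IsCycle) : c.support.toFinset.card = c.length := by
  have : c.support.toFinset = c.support.tail.toFinset := by
    ext z
    rw [List.mem_toFinset, List.mem_toFinset, ← c.cons_tail_support, List.mem_cons,
      List.tail_cons]
    exact ⟨fun h => h.elim (fun h => h ▸ c.end_mem_tail_support hc.not_nil) id, .inr⟩
  rw [this, List.toFinset_card_of_nodup hc.support_nodup]
  simp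

/-- The cost, in half units, of a ball of radius `r` with respect to cycles of length `3 * b`. -/
def ballCost (b r : ℕ) : ℕ := if 2 * r + 2 ≤ b then 1 else 2

theorem two_mul_add_two_le_ballCost_mul {b r : ℕ} (h : r < b) : 2 * r + 2 ≤ ballCost b r * b := by
  unfold ballCost
  split_ifs <;> omega

theorem ballCost_le_two (b r : ℕ) : ballCost b r ≤ 2 := by
  unfold ballCost
  split_ifs <;> omega

theorem sum_range_ballCost (b n : ℕ) :
    ∑ r ∈ Finset.range n, ballCost b r + min n (b / 2) = 2 * n := by
  induction n with
  | zero => simp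
  | succ n ih =>
    rw [Finset.sum_range_succ]
    unfold ballCost at *
    split_ifs <;> omega

/-- If finitely many balls of radius less than `b` cover a family of cycles of length at least
`3 * b`, where the cycle `S i` is attached to the rest of the graph through the gates `p i`, then
the total cost of the balls is at least twice the number of cycles. -/
theorem two_mul_card_le_sum_ballCost (hG : G.Connected) {ι κ : Type*} (S : ι → Finset V)
    (p : ι → V → V) (hmem : ∀ i x, p i x ∈ S i) (hself : ∀ i, ∀ x ∈ S i, p i x = x)
    (hsep : ∀ i x y, p i x ≠ p i y → G.dist x y = G.dist x (p i x) + G.dist (p i x) y)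
    (hconst : ∀ i j, i ≠ j → ∀ x ∈ S j, ∀ y ∈ S j, p i x = p i y)
    (hball : ∀ i x r, ((S i).filter fun y => G.dist x y ≤ r).card ≤ 2 * r + 1)
    {b : ℕ} (hcard : ∀ i, 3 * b ≤ (S i).card)
    (x : κ → V) (r : κ → ℕ) (hr : ∀ k, r k < b) (I : Finset ι) (K : Finset κ)
    (hcov : ∀ i ∈ I, ∀ y ∈ S i, ∃ k ∈ K, G.dist (x k) y ≤ r k) :
    2 * I.card ≤ ∑ k ∈ K, ballCost b (r k) := by
  classical
  induction hn : I.card generalizing I K with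
  | zero => simp
  | succ n ih =>
  have hne : I.Nonempty := Finset.card_pos.1 (by omega)
  obtain ⟨v⟩ := hG.nonempty
  -- a cycle `i` whose attachment vertex `ρ` is farthest from `v` separates no two other cycles
  obtain ⟨i, hi, hmax⟩ := I.exists_max_image (fun i => G.dist v (p i v)) hne
  set ρ := p i v with hρ
  have hρS : ρ ∈ S i := hmem i v
  have hρρ : p i ρ = ρ := hself i ρ hρS
  have hleaf : ∀ j ∈ I, j ≠ i → ∀ y ∈ S j, p i y = ρ := by
    intro j hj hji y hy
    by_contra hy'
    have hm : p i (p j v) ≠ ρ := by rwa [hconst i j hji.symm _ (hmem j v) y hy]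
    have h1 := hsep i v (p j v) (Ne.symm hm)
    have h2 := hmax j hj
    have h3 : G.dist ρ (p j v) ≠ 0 := by
      rw [Ne, hG.dist_eq_zero_iff]
      intro h
      rw [← h, hρρ] at hm
      exact hm rfl
    simp only [← hρ] at h1 h2
    omega
  have hbelow : ∀ k, p i (x k) ≠ ρ → ∀ y, p i y = ρ →
      G.dist (x k) y = G.dist (x k) ρ + G.dist ρ y := by
    intro k hk y hy
    have := hsep i y (x k) (by rw [hy]; exact hk.symm)
    rw [hy, dist_comm, dist_comm (u := y), dist_comm (u := ρ) (v := x k)] at this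
    omega
  have habove : ∀ k, p i (x k) = ρ → ∀ y ∈ S i,
      G.dist (x k) y = G.dist (x k) ρ + G.dist ρ y := by
    intro k hk y hy
    by_cases hyρ : y = ρ
    · simp [hyρ]
    · have := hsep i (x k) y (by rw [hk, hself i y hy]; exact Ne.symm hyρ)
      rwa [hk] at this
  obtain ⟨k₁, hk₁, hk₁ρ⟩ := hcov i hi ρ hρS
  obtain ⟨k₀, hk₀, hk₀max⟩ := K.exists_max_image
    (fun k => (r k : ℤ) - G.dist (x k) ρ) ⟨k₁, hk₁⟩
  have hk₀dom : ∀ k ∈ K, ∀ y, G.dist (x k) ρ + G.dist ρ y ≤ r k → G.dist (x k₀) y ≤ r k₀ := by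
    intro k hk y hy
    have h1 := hk₀max k hk
    have h2 : G.dist (x k₀) y ≤ _ := hG.dist_triangle (v := ρ)
    omega
  set A := K.filter fun k => p i (x k) = ρ with hA
  set B := K.filter fun k => ¬ p i (x k) = ρ with hB
  have hsplit : ∑ k ∈ A, ballCost b (r k) + ∑ k ∈ B, ballCost b (r k)
      = ∑ k ∈ K, ballCost b (r k) := Finset.sum_filter_add_sum_filter_not _ _ _
  have hrest : 2 * n ≤ ∑ k ∈ insert k₀ A, ballCost b (r k) := by
    refine ih (I.erase i) (insert k₀ A) ?_ (by rw [Finset.card_erase_of_mem hi, hn]; rfl)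
    intro j hj y hy
    rw [Finset.mem_erase] at hj
    obtain ⟨k, hk, hky⟩ := hcov j hj.2 y hy
    by_cases hkρ : p i (x k) = ρ
    · exact ⟨k, Finset.mem_insert_of_mem (by simp [hA, hk, hkρ]), hky⟩
    · rw [hbelow k hkρ y (hleaf j hj.2 hj.1 y hy)] at hky
      exact ⟨k₀, Finset.mem_insert_self _ _, hk₀dom k hk y hky⟩
  -- the balls of `B`, together with `k₀`, already cover the cycle `i`
  have hcovi : S i ⊆ ((S i).filter fun y => G.dist (x k₀) y ≤ r k₀ ) ∪
      B.biUnion fun k => (S i).filter fun y => G.dist (x k) y ≤ r k := by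
    intro y hy
    obtain ⟨k, hk, hky⟩ := hcov i hi y hy
    simp only [Finset.mem_union, Finset.mem_filter, Finset.mem_biUnion]
    by_cases hkρ : p i (x k) = ρ
    · rw [habove k hkρ y hy] at hky
      exact .inl ⟨hy, hk₀dom k hk y hky⟩
    · exact .inr ⟨k, by simp [hB, hk, hkρ], hy, hky⟩
  have hBcard : (B.biUnion fun k => (S i).filter fun y => G.dist (x k) y ≤ r k).card + B.card
      ≤ (∑ k ∈ B, ballCost b (r k)) * b := by
    rw [Finset.sum_mul, Finset.card_eq_sum_ones B]
    grw [Finset.card_biUnion_le]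
    rw [← Finset.sum_add_distrib]
    exact Finset.sum_le_sum fun k _ => (Nat.add_le_add_right (hball i (x k) (r k)) 1).trans
      (two_mul_add_two_le_ballCost_mul (hr k))
  have hunion := (Finset.card_le_card hcovi).trans (Finset.card_union_le _ _)
  have h3 := hcard i
  have hk₀ball := hball i (x k₀) (r k₀)
  have hk₀b := hr k₀
  rw [Nat.mul_add]
  by_cases hk₀ρ : p i (x k₀) = ρ
  · rw [Finset.insert_eq_of_mem (by simp [hA, hk₀, hk₀ρ])] at hrest
    have : 1 < ∑ k ∈ B, ballCost b (r k) := by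
      by_contra! hle
      have := Nat.mul_le_mul_right b hle
      omega
    omega
  · have hk₀B : k₀ ∈ B := by simp [hB, hk₀, hk₀ρ]
    rw [Finset.sum_insert (by simp [hA, hk₀ρ])] at hrest
    have hcovB : S i ⊆ B.biUnion fun k => (S i).filter fun y => G.dist (x k) y ≤ r k :=
      hcovi.trans (Finset.union_subset (Finset.subset_biUnion_of_mem
        (fun k => (S i).filter fun y => G.dist (x k) y ≤ r k) hk₀B) subset_rfl)
    have hcardB := Finset.card_le_card hcovB
    have hBpos : 0 < B.card := Finset.card_pos.2 ⟨k₀, hk₀B⟩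
    have hcost := ballCost_le_two b (r k₀)
    have : 3 < ∑ k ∈ B, ballCost b (r k) := by
      by_contra! hle
      have := Nat.mul_le_mul_right b hle
      omega
    omega

end Cactus

/-- Lemma 4 of the paper. If a cactus `G` contains `⌈0.75b⌉ + 1`
distinct simple cycles, each of length at least `3b`, then `b(G) > b`. -/
theorem stmt3 {V : Type*} [Fintype V] (G : SimpleGraph V) (hG : IsCactus G)
    (b : ℕ) (hb : 0 < b)
    (cy : Fin (⌈(0.75 : ℚ) * b⌉₊ + 1) → Σ u : V, G.Walk u u)
    (hcyc : ∀ i, (cy i).2.IsCycle)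
    (hlen : ∀ i, 3 * b ≤ (cy i).2.length)
    (hdistinct : ∀ i j, i ≠ j →
      {x | x ∈ (cy i).2.support} ≠ {x | x ∈ (cy j).2.support}) :
    b < burnNumber G := by
  classical
  have hmem : burnNumber G ∈
      {k | ∃ x : Fin k → V, ∀ v, ∃ i : Fin k, G.dist (x i) v ≤ k - 1 - (i : ℕ)} :=
    Nat.sInf_mem ⟨Fintype.card V, (Fintype.equivFin V).symm, fun v =>
      ⟨Fintype.equivFin V v, by simp⟩⟩
  by_contra! hle
  generalize burnNumber G = n at hmem hle
  obtain ⟨x, hx⟩ := hmem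
  have hbound := two_mul_card_le_sum_ballCost hG.1 (fun i => (cy i).2.support.toFinset)
    (fun i => cycleGate hG.1 (cy i).2)
    (fun i x => by simpa using cycleGate_mem hG.1 (cy i).2 x)
    (fun i x h => hG.gate_eq_self (hcyc i) (by simpa using h))
    (fun i x y h => hG.dist_eq_add_of_gate_ne (hcyc i) h)
    (fun i j hij x hx y hy => hG.gate_eq_of_mem_cycle (hcyc i) (hcyc j) (hdistinct i j hij)
      (by simpa using hx) (by simpa using hy))
    (fun i x r => hG.card_ball_inter_cycle_le (hcyc i) x r)
    (fun i => (hlen i).trans (hcyc i).card_support_toFinset.ge)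
    x (fun k => n - 1 - k) (fun k => by omega) Finset.univ Finset.univ
    (fun i _ y _ => by simpa using hx y)
  rw [Fin.sum_univ_eq_sum_range (fun k => ballCost b (n - 1 - k)) n,
    Finset.sum_range_reflect (ballCost b) n, Finset.card_univ, Fintype.card_fin] at hbound
  have hsum := sum_range_ballCost b n
  have hceil : 3 * b ≤ 4 * ⌈(0.75 : ℚ) * b⌉₊ := by
    have h := Nat.le_ceil ((0.75 : ℚ) * b)
    have : (3 * b : ℚ) ≤ 4 * ⌈(0.75 : ℚ) * b⌉₊ := by linarith
    exact_mod_cast this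
  omega
end

section
/- Let G be a connected undirected graph and let b be a positive integer. If G contains b vertices at pairwise distance at least 2b−1, then b(G) ≥ b. -/
open SimpleGraph

/-- Lemma from Bonato et al.. If a connected graph `G` contains `b`
vertices at pairwise distance at least `2b - 1`, then `b(G) ≥ b`. -/
theorem stmt4 {V : Type*} [Fintype V] (G : SimpleGraph V) (hconn : G.Connected)
    (b : ℕ) (hb : 0 < b)
    (x : Fin b → V)
    (hx : ∀ i j, i ≠ j → 2 * b - 1 ≤ G.dist (x i) (x j)) :
    b ≤ burnNumber G := by
  have hne : {k | ∃ x : Fin k → V, ∀ v, ∃ i : Fin k,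
      G.dist (x i) v ≤ k - 1 - (i : ℕ)}.Nonempty := by
    refine ⟨Fintype.card V, (Fintype.equivFin V).symm, fun v => ⟨Fintype.equivFin V v, ?_⟩⟩
    simp
  obtain ⟨y, hy⟩ := Nat.sInf_mem hne
  change b ≤ sInf _
  by_contra! hlt
  choose f hf using fun i => hy (x i)
  obtain ⟨i, j, hij, hfij⟩ := Fintype.exists_ne_map_eq_of_card_lt f (by simpa using hlt)
  have hi := hf i
  have hj := hf j
  rw [← hfij] at hj
  rw [G.dist_comm] at hi
  have htri := hconn.dist_triangle (u := x i) (v := y (f i)) (w := x j)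
  have hdist := hx i j hij
  omega
end

section
/- Let G be a connected undirected graph and let b be a positive integer. If G contains b+1 vertices at pairwise distance at least 2b−1, then b(G) ≥ b+1. -/
open SimpleGraph

/-- Corollary 1 of the paper. If a connected graph `G` contains
`b + 1` vertices at pairwise distance at least `2b - 1`, then `b(G) ≥ b + 1`. -/
theorem stmt5 {V : Type*} [Fintype V] (G : SimpleGraph V) (hconn : G.Connected)
    (b : ℕ) (hb : 0 < b)
    (x : Fin (b + 1) → V)
    (hx : ∀ i j, i ≠ j → 2 * b - 1 ≤ G.dist (x i) (x j)) :
    b + 1 ≤ burnNumber G := by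
  have hne : {k | ∃ x : Fin k → V, ∀ v, ∃ i : Fin k,
      G.dist (x i) v ≤ k - 1 - (i : ℕ)}.Nonempty :=
    ⟨Fintype.card V, (Fintype.equivFin V).symm, fun v => ⟨Fintype.equivFin V v, by simp⟩⟩
  refine le_csInf hne ?_
  rintro k ⟨y, hy⟩
  by_contra! hk
  choose f hf using fun j => hy (x j)
  obtain ⟨i, j, hij, hfij⟩ := Fintype.exists_ne_map_eq_of_card_lt f (by simpa using hk)
  have hi := hf i
  have hj := hf j
  rw [← hfij] at hj
  rw [dist_comm] at hi
  have htri := hconn.dist_triangle (u := x i) (v := y (f i)) (w := x j)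
  have hsep := hx i j hij
  omega
end
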